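/- arXiv:1707.06078 — 2 statements merged into one kernel-verified Lean document; each statement's English description precedes it below -/
import Mathlib

section
/- For the quaternion group Q₈ of order 8, the dimensions over F₂ of the mod 2 group cohomology are periodic of period 4: dim H^q(Q₈; F₂) = 1, 2, 2, 1 for q ≡ 0, 1, 2, 3 mod 4 respectively. -/
namespace Q8
open QuaternionGroup

abbrev G := QuaternionGroup 2
abbrev k := ZMod 2

/-- ranks -/
def r : ℕ → ℕ
  | 0 => 1
  | 1 => 2
  | 2 => 2
  | 3 => 1
  | n + 4 => r n

/-- indicator of a list -/
def ind (l : List G) (g : G) : k := if g ∈ l then 1 else 0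

def D : (n : ℕ) → Fin (r (n + 1)) → Fin (r n) → G → k
  | 0 => fun i _ => if i.val = 0 then ind [a 0, a 1] else ind [a 0, xa 0]
  | 1 => fun i j => if i.val = 0 then (if j.val = 0 then ind [a 0, a 1] else ind [a 0, xa 0])
      else (if j.val = 0 then ind [a 0, xa 3] else ind [a 0, a 1])
  | 2 => fun _ j => if j.val = 0 then ind [a 0, a 1] else ind [a 0, xa 3]
  | 3 => fun _ _ _ => 1
  | n + 4 => D n

def idx : G → ℕ
  | a i => i.val
  | xa i => 4 + i.val

def tab : ℕ → List ℕ
  | 0 => [0, 1, 3, 7, 256, 272, 304, 368]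
  | 1 => [0, 0, 0, 836, 0, 0, 0, 785, 0, 529, 17, 381, 1, 561, 849, 531]
  | 2 => [0, 0, 0, 0, 0, 0, 0, 90, 0, 0, 36, 24, 16, 32, 2, 254]
  | 3 => [1, 0, 0, 0, 0, 0, 0, 0]
  | n + 4 => tab n

def M (n : ℕ) : Matrix (Fin (r n) × G) (Fin (r (n + 1)) × G) k :=
  fun p q => D n q.1 p.1 (q.2⁻¹ * p.2)

def S (n : ℕ) : Matrix (Fin (r (n + 1)) × G) (Fin (r n) × G) k :=
  fun q p => if ((tab n).getD (8 * p.1.val + idx p.2) 0).testBit (8 * q.1.val + idx q.2)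
    then 1 else 0

theorem hMM : ∀ n, M n * M (n + 1) = 0
  | 0 => by decide +kernel
  | 1 => by decide +kernel
  | 2 => by decide +kernel
  | 3 => by decide +kernel
  | n + 4 => hMM n

theorem hMS : ∀ n, M (n + 1) * S (n + 1) + S n * M n = 1
  | 0 => by decide +kernel
  | 1 => by decide +kernel
  | 2 => by decide +kernel
  | 3 => by decide +kernel
  | n + 4 => hMS n

theorem hD0 : ∀ n (i : Fin (r (n + 1))) (j : Fin (r n)), ∑ g, D n i j g = 0
  | 0 => by decide +kernel
  | 1 => by decide +kernel
  | 2 => by decide +kernel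
  | 3 => by decide +kernel
  | n + 4 => hD0 n

theorem hr : ∀ q, r q = (if q % 4 = 0 then 1 else if q % 4 = 1 then 2 else if q % 4 = 2 then 2 else 1)
  | 0 => rfl
  | 1 => rfl
  | 2 => rfl
  | 3 => rfl
  | n + 4 => by rw [Nat.add_mod_right]; exact hr n

open CategoryTheory

noncomputable def E (α : Type) [Finite α] : (α →₀ MonoidAlgebra k G) ≃ₗ[k] (α × G → k) :=
  Finsupp.mapRange.linearEquiv (MonoidAlgebra.coeffLinearEquiv k) ≪≫ₗ
    (Finsupp.curryLinearEquiv k).symm ≪≫ₗ Finsupp.linearEquivFunOnFinite k k _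

theorem E_apply (α : Type) [Finite α] (x : α →₀ MonoidAlgebra k G) (p : α × G) :
    E α x p = (x p.1).coeff p.2 := by
  simp [E, Finsupp.curryLinearEquiv, Finsupp.uncurry_apply]

noncomputable abbrev X (n : ℕ) : Rep k G := Rep.free k G (Fin (r n))

noncomputable def d (n : ℕ) : X (n + 1) ⟶ X n :=
  Rep.freeLift k G (X n) (fun i => (E (Fin (r n))).symm (fun p => D n i p.1 p.2))

theorem E_single (α : Type) [Finite α] [DecidableEq α] (i : α) (g : G) :
    E α (Finsupp.single i (MonoidAlgebra.single g (1 : k))) = Pi.single (i, g) 1 := by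
  ext q
  rw [E_apply]
  by_cases h : q.1 = i
  · subst h
    by_cases h' : q.2 = g
    · subst h'; simp
    · simp [Pi.single_apply, Prod.ext_iff, Finsupp.single_apply, h', Ne.symm h']
  · simp [Pi.single_apply, Prod.ext_iff, Finsupp.single_apply, h, Ne.symm h]

theorem E_rho (α : Type) [Finite α] (g : G) (x : α →₀ MonoidAlgebra k G) (p : α × G) :
    E α (Representation.free k G α g x) p = E α x (p.1, g⁻¹ * p.2) := by
  classical
  suffices h : LinearMap.proj p ∘ₗ (E α).toLinearMap ∘ₗ Representation.free k G α g =
      LinearMap.proj (p.1, g⁻¹ * p.2) ∘ₗ (E α).toLinearMap from LinearMap.congr_fun h x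
  ext i h
  simp [E_single, Pi.single_apply, Prod.ext_iff, inv_mul_eq_iff_eq_mul]

theorem E_d (n : ℕ) (x : X (n + 1)) :
    E (Fin (r n)) ((d n).hom x) = (M n).mulVec (E (Fin (r (n + 1))) x) := by
  suffices h : (E (Fin (r n))).toLinearMap ∘ₗ (d n).hom.toLinearMap =
      (M n).mulVecLin ∘ₗ (E (Fin (r (n + 1)))).toLinearMap from LinearMap.congr_fun h x
  ext i g p
  have h1 : (d n).hom (Finsupp.single i (MonoidAlgebra.single g (1 : k))) =
      Representation.free k G (Fin (r n)) g ((E (Fin (r n))).symm (fun p => D n i p.1 p.2)) := by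
    simp [d]
  have h3 : E (Fin (r n)) ((d n).hom (Finsupp.single i (MonoidAlgebra.single g (1 : k)))) p =
      (M n).mulVec (E (Fin (r (n+1))) (Finsupp.single i (MonoidAlgebra.single g (1 : k)))) p := by
    rw [h1, E_single, E_rho]
    simp [M]
  simpa using! h3

theorem d_d (n : ℕ) : d (n + 1) ≫ d n = 0 := by
  refine Rep.hom_ext (Representation.IntertwiningMap.ext (LinearMap.ext fun x => ?_))
  apply (E _).injective
  have := E_d n ((d (n+1)).hom x)
  rw [E_d (n + 1), Matrix.mulVec_mulVec, hMM, Matrix.zero_mulVec] at this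
  simpa using! this

theorem d_exact (n : ℕ) (x : X (n + 1)) (hx : (d n).hom x = 0) :
    ∃ y, (d (n + 1)).hom y = x := by
  refine ⟨(E _).symm ((S (n + 1)).mulVec (E _ x)), (E _).injective ?_⟩
  rw [E_d, LinearEquiv.apply_symm_apply, Matrix.mulVec_mulVec]
  have h1 := congrArg (fun A => A.mulVec (E _ x)) (hMS n)
  simp only [Matrix.add_mulVec, Matrix.one_mulVec, ← Matrix.mulVec_mulVec, ← E_d, hx] at h1
  simpa using h1

noncomputable def eps : X 0 ⟶ Rep.trivial k G k := Rep.freeLift k G (Rep.trivial k G k) (fun _ => (1 : k))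

theorem eps_apply (x : X 0) : eps.hom x = ∑ p, E (Fin (r 0)) x p := by
  suffices h : eps.hom.toLinearMap =
      (∑ p, LinearMap.proj p) ∘ₗ (E (Fin (r 0))).toLinearMap by
    have := LinearMap.congr_fun h x
    simpa using! this
  ext i g
  have h1 : eps.hom (Finsupp.single i (MonoidAlgebra.single g (1 : k))) = (1 : k) := by
    simp [eps]
  have h2 : ∑ p, E (Fin (r 0)) (Finsupp.single i (MonoidAlgebra.single g (1 : k))) p = 1 := by
    simp [E_single]
  simpa [h2] using! h1

theorem d_eps : d 0 ≫ eps = 0 := by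
  refine Rep.free_ext _ _ _ _ _ fun i => ?_
  have h1 : eps.hom ((d 0).hom (Finsupp.single i (MonoidAlgebra.single 1 (1 : k)))) = 0 := by
    rw [eps_apply]
    have : (d 0).hom (Finsupp.single i (MonoidAlgebra.single 1 (1 : k))) =
      ((E (Fin (r 0))).symm (fun p => D 0 i p.1 p.2)) := by simp [d]
    rw [this]
    simp [Fintype.sum_prod_type, hD0]
  simpa using! h1

theorem eps_exact (x : X 0) (hx : eps.hom x = 0) : ∃ y, (d 0).hom y = x := by
  have h4 : ∀ x : X (3 + 1), ∑ p, E (Fin (r (3 + 1))) x p = 0 → (d 3).hom x = 0 := by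
    intro x hx
    refine (E _).injective ?_
    rw [E_d]
    ext p
    simpa [M, Matrix.mulVec, dotProduct, D] using hx
  rw [eps_apply] at hx
  exact d_exact 3 x (h4 x hx)

theorem eps_surj : Function.Surjective eps.hom := by
  intro c
  refine ⟨Finsupp.single (0 : Fin 1) (MonoidAlgebra.single 1 c), ?_⟩
  refine (Representation.freeLift_single_single (Representation.trivial k G k) (0 : Fin 1) 1 c
    (fun _ => (1 : k))).trans ?_
  simp

noncomputable def C : ChainComplex (Rep k G) ℕ := ChainComplex.of X d d_d

theorem C_d (n : ℕ) : C.d (n + 1) n = d n := ChainComplex.of_d ..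

noncomputable def piC : C ⟶ (ChainComplex.single₀ (Rep k G)).obj (Rep.trivial k G k) :=
  (C.toSingle₀Equiv _).symm ⟨eps, by
    have := d_eps
    rw [← C_d] at this
    exact this⟩

instance : QuasiIso piC where
  quasiIsoAt m := by
    cases m with
    | zero =>
      simp only [piC]
      rw [ChainComplex.quasiIsoAt₀_iff, ShortComplex.quasiIso_iff_of_zeros' _ rfl rfl rfl]
      constructor
      · apply (forget₂ _ (ModuleCat k)).reflects_exact_of_faithful
        rw [ShortComplex.moduleCat_exact_iff]
        intro x hx
        obtain ⟨y, hy⟩ := eps_exact x (by simpa [ChainComplex.toSingle₀Equiv] using! hx)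
        rw [← C_d] at hy
        exact ⟨y, hy⟩
      · rw [Rep.epi_iff_surjective]
        intro c
        obtain ⟨y, hy⟩ := eps_surj c
        exact ⟨y, by simpa [ChainComplex.toSingle₀Equiv] using! hy⟩
    | succ m =>
      rw [quasiIsoAt_iff_exactAt' (hL := ChainComplex.exactAt_succ_single_obj ..),
          HomologicalComplex.exactAt_iff' _ (m + 2) (m + 1) m (by simp) (by simp)]
      apply (forget₂ _ (ModuleCat k)).reflects_exact_of_faithful
      rw [ShortComplex.moduleCat_exact_iff]
      intro x hx
      obtain ⟨y, hy⟩ := d_exact m x (by rw [← C_d]; exact hx)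
      rw [← C_d] at hy
      exact ⟨y, hy⟩

noncomputable def res : ProjectiveResolution (Rep.trivial k G k) where
  complex := C
  projective n := (inferInstance : Projective (X n))
  π := piC

theorem d_comp (n : ℕ) (f : X n ⟶ Rep.trivial k G k) : d n ≫ f = 0 := by
  have key : ∀ x : X n, f.hom x =
      ∑ p : Fin (r n) × G, E _ x p * f.hom (Finsupp.single p.1 (MonoidAlgebra.single 1 (1 : k))) := by
    intro x
    suffices h : f.hom.toLinearMap =
        (∑ p : Fin (r n) × G,
          (f.hom (Finsupp.single p.1 (MonoidAlgebra.single 1 (1 : k))) : k) • LinearMap.proj p) ∘ₗ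
          (E (Fin (r n))).toLinearMap by
      have := LinearMap.congr_fun h x
      simpa [mul_comm] using! this
    ext i g
    have h1 : f.hom (Finsupp.single i (MonoidAlgebra.single g (1 : k))) =
        f.hom (Finsupp.single i (MonoidAlgebra.single 1 (1 : k))) := by
      have := Rep.hom_comm_apply f g (Finsupp.single i (MonoidAlgebra.single 1 (1 : k)))
      simpa using! this
    simpa [E_single, Pi.single_apply] using! h1
  refine Rep.free_ext _ _ _ _ _ fun i => ?_
  have h1 : f.hom ((d n).hom (Finsupp.single i (MonoidAlgebra.single 1 (1 : k)))) = 0 := by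
    rw [key]
    have : (d n).hom (Finsupp.single i (MonoidAlgebra.single 1 (1 : k))) =
      ((E (Fin (r n))).symm (fun p => D n i p.1 p.2)) := by simp [d]
    rw [this]
    simp [Fintype.sum_prod_type, ← Finset.sum_mul, hD0]
  simpa using! h1

noncomputable abbrev Y := C.linearYonedaObj k (Rep.trivial k G k)

theorem Y_d (i j : ℕ) : Y.d i j = 0 := by
  by_cases h : i + 1 = j
  · subst h
    ext f
    have := d_comp i f
    rw [← C_d] at this
    simpa [ChainComplex.linearYonedaObj] using! this
  · exact Y.shape _ _ h

theorem finrank_eq (q : ℕ) : Module.finrank k (groupCohomology (Rep.trivial k G k) q) = r q := by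
  have e1 : groupCohomology (Rep.trivial k G k) q ≅ Y.homology q :=
    groupCohomologyIso _ q res
  have e2 : Y.cycles q ≅ Y.homology q := Y.isoHomologyπ _ q rfl (Y_d _ _)
  have e3 : Y.cycles q ≅ Y.X q :=
    haveI := Y.isIso_iCycles q _ rfl (Y_d _ _)
    asIso (Y.iCycles q)
  have e4 : (X q ⟶ Rep.trivial k G k) ≃ₗ[k] (Fin (r q) → k) :=
    Rep.freeLiftLEquiv k G (Fin (r q)) (Rep.trivial k G k)
  rw [(e1 ≪≫ e2.symm ≪≫ e3).toLinearEquiv.finrank_eq]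
  exact e4.finrank_eq.trans (by simp)

end Q8


/-- The mod 2 cohomology of the quaternion group Q₈ (= QuaternionGroup 2) has
dimensions 1, 2, 2, 1 in degrees q ≡ 0, 1, 2, 3 mod 4 respectively. -/
theorem stmt_5 (q : ℕ) :
    Module.finrank (ZMod 2)
      (groupCohomology (Rep.trivial (ZMod 2) (QuaternionGroup 2) (ZMod 2)) q) =
      (if q % 4 = 0 then 1 else if q % 4 = 1 then 2 else if q % 4 = 2 then 2 else 1) := by
  rw [← Q8.hr]; exact Q8.finrank_eq q
end

section
/- For the binary tetrahedral group Te (of order 24, isomorphic to SL₂(F₃)), the mod 2 cohomology with F₂ coefficients satisfies H^q(Te; F₂) ≅ F₂ if q ≡ 0 or 3 mod 4, and H^q(Te; F₂) = 0 if q ≡ 1 or 2 mod 4. -/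
namespace BinTet

open CategoryTheory

/-- The binary tetrahedral group. -/
abbrev G := Matrix.SpecialLinearGroup (Fin 2) (ZMod 3)

/-- The coefficient field. -/
abbrev k := ZMod 2

/-! ### Evaluating bit masks -/

/-- The linear functional on `Fin 24 → k` attached to a bit mask. -/
def ev (m : ℕ) (φ : Fin 24 → k) : k := ∑ j : Fin 24, if m.testBit j then φ j else 0

lemma ev_xor (m n : ℕ) (φ : Fin 24 → k) : ev (m ^^^ n) φ = ev m φ + ev n φ := by
  unfold ev
  rw [← Finset.sum_add_distrib]
  refine Finset.sum_congr rfl fun j _ => ?_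
  rw [Nat.testBit_xor]
  cases m.testBit j <;> cases n.testBit j <;> simp [CharTwo.add_self_eq_zero]

lemma ev_pow (i : Fin 24) (φ : Fin 24 → k) : ev (2 ^ (i : ℕ)) φ = φ i := by
  unfold ev
  rw [Finset.sum_eq_single i]
  · simp
  · intro b _ hb
    have : (i : ℕ) ≠ b := fun h => hb (Fin.ext h.symm)
    simp [Nat.testBit_two_pow_of_ne this]
  · simp

lemma ev_zero_mask (φ : Fin 24 → k) : ev 0 φ = 0 := by simp [ev]

lemma ev_zero (m : ℕ) (φ : Fin 24 → k) (h : ∀ i, φ i = 0) : ev m φ = 0 := by simp [ev, h]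

/-- Row vector times matrix, for bit masks. -/
def comb (m : ℕ) (R : Fin 24 → ℕ) : ℕ :=
  (List.finRange 24).foldr (fun (j : Fin 24) (acc : ℕ) => (if m.testBit j then R j else 0) ^^^ acc) 0

lemma ev_comb (m : ℕ) (R : Fin 24 → ℕ) (φ : Fin 24 → k) :
    ev (comb m R) φ = ev m (fun j => ev (R j) φ) := by
  have key : ∀ l : List (Fin 24),
      ev (l.foldr (fun (j : Fin 24) (acc : ℕ) => (if m.testBit j then R j else 0) ^^^ acc) 0) φ =
        (l.map (fun (j : Fin 24) => if m.testBit j then ev (R j) φ else 0)).sum := by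
    intro l
    induction l with
    | nil => simp [ev_zero_mask]
    | cons a l ih =>
      rw [List.foldr_cons, ev_xor, ih, List.map_cons, List.sum_cons]
      split <;> simp [ev_zero_mask]
  rw [comb, key, ← Fin.sum_univ_def, ev]

/-! ### Enumeration of the group -/

/-- Entries of the 24 elements. -/
def entries : List (ZMod 3 × ZMod 3 × ZMod 3 × ZMod 3) :=
    [(0, 1, 2, 0), (0, 1, 2, 1), (0, 1, 2, 2), (0, 2, 1, 0), (0, 2, 1, 1), (0, 2, 1, 2), (1, 0, 0,
    1), (1, 0, 1, 1), (1, 0, 2, 1), (1, 1, 0, 1), (1, 1, 1, 2), (1, 1, 2, 0), (1, 2, 0, 1), (1, 2,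
    1, 0), (1, 2, 2, 2), (2, 0, 0, 2), (2, 0, 1, 2), (2, 0, 2, 2), (2, 1, 0, 2), (2, 1, 1, 1), (2,
    1, 2, 0), (2, 2, 0, 2), (2, 2, 1, 0), (2, 2, 2, 1)]

/-- The entries of the `i`-th element. -/
def ent (i : Fin 24) : ZMod 3 × ZMod 3 × ZMod 3 × ZMod 3 := entries.getD i (1, 0, 0, 1)

lemma ent_det : ∀ i, (ent i).1 * (ent i).2.2.2 - (ent i).2.1 * (ent i).2.2.1 = 1 := by
  decide +kernel

/-- The enumeration of the group. -/
def e (i : Fin 24) : G :=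
  ⟨!![(ent i).1, (ent i).2.1; (ent i).2.2.1, (ent i).2.2.2], by
    rw [Matrix.det_fin_two_of]; exact ent_det i⟩

/-- Lookup table for the inverse of the enumeration. -/
def idxTable : List ℕ :=
    [0, 0, 0, 0, 0, 0, 0, 0, 0, 0, 0, 0, 0, 0, 0, 0, 1, 2, 0, 0, 0, 3, 4, 5, 0, 0, 0, 0, 6, 0, 0,
    7, 0, 0, 8, 0, 0, 9, 0, 0, 0, 10, 11, 0, 0, 0, 12, 0, 13, 0, 0, 0, 0, 14, 0, 0, 15, 0, 0, 16,
    0, 0, 17, 0, 0, 18, 0, 19, 0, 20, 0, 0, 0, 0, 21, 22, 0, 0, 0, 23, 0]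

/-- The index of the matrix with given entries. -/
def idx4 (a b c d : ZMod 3) : Fin 24 :=
  Fin.ofNat 24 (idxTable.getD (27 * a.val + 9 * b.val + 3 * c.val + d.val) 0)

lemma ent_idx4 : ∀ a b c d : ZMod 3, a * d - b * c = 1 → ent (idx4 a b c d) = (a, b, c, d) := by
  decide +kernel

lemma idx4_ent : ∀ i : Fin 24,
    idx4 (ent i).1 (ent i).2.1 (ent i).2.2.1 (ent i).2.2.2 = i := by
  decide +kernel

/-- The index of a group element. -/
def idx (g : G) : Fin 24 := idx4 (g.1 0 0) (g.1 0 1) (g.1 1 0) (g.1 1 1)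

lemma e_idx (g : G) : e (idx g) = g := by
  have h : g.1 0 0 * g.1 1 1 - g.1 0 1 * g.1 1 0 = 1 := by
    rw [← Matrix.det_fin_two]; exact g.2
  have := ent_idx4 _ _ _ _ h
  apply Subtype.ext
  ext i j
  simp only [e, idx, this]
  fin_cases i <;> fin_cases j <;> rfl

lemma idx_e (i : Fin 24) : idx (e i) = i := idx4_ent i

/-- The index of a product. -/
def sig (j i : Fin 24) : Fin 24 := idx (e j * e i)

lemma e_mul (j i : Fin 24) : e j * e i = e (sig j i) := (e_idx _).symm

/-- Left multiplication by the element of index 0. -/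
def s0 (i : Fin 24) : Fin 24 := Fin.ofNat 24 (List.getD
    [15, 18, 21, 6, 9, 12, 0, 11, 20, 2, 14, 17, 1, 8, 23, 3, 13, 22, 5, 10, 16, 4, 7, 19] i 0)

lemma sig_0 : ∀ i, sig 0 i = s0 i := by decide +kernel

/-- Left multiplication by the element of index 1. -/
def s1 (i : Fin 24) : Fin 24 := Fin.ofNat 24 (List.getD
    [17, 20, 23, 7, 10, 13, 1, 9, 19, 0, 12, 16, 2, 6, 22, 5, 14, 21, 4, 11, 15, 3, 8, 18] i 0)

lemma sig_1 : ∀ i, sig 1 i = s1 i := by decide +kernel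

/-- Left multiplication by the element of index 2. -/
def s2 (i : Fin 24) : Fin 24 := Fin.ofNat 24 (List.getD
    [16, 19, 22, 8, 11, 14, 2, 10, 18, 1, 13, 15, 0, 7, 21, 4, 12, 23, 3, 9, 17, 5, 6, 20] i 0)

lemma sig_2 : ∀ i, sig 2 i = s2 i := by decide +kernel

/-- Left multiplication by the element of index 8. -/
def s8 (i : Fin 24) : Fin 24 := Fin.ofNat 24 (List.getD
    [2, 0, 1, 4, 5, 3, 8, 6, 7, 11, 9, 10, 14, 12, 13, 16, 17, 15, 19, 20, 18, 22, 23, 21] i 0)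

lemma sig_8 : ∀ i, sig 8 i = s8 i := by decide +kernel

/-- Left multiplication by the element of index 9. -/
def s9 (i : Fin 24) : Fin 24 := Fin.ofNat 24 (List.getD
    [20, 23, 17, 13, 7, 10, 9, 19, 1, 12, 16, 0, 6, 22, 2, 21, 5, 14, 15, 4, 11, 18, 3, 8] i 0)

lemma sig_9 : ∀ i, sig 9 i = s9 i := by decide +kernel

/-- Left multiplication by the element of index 12. -/
def s12 (i : Fin 24) : Fin 24 := Fin.ofNat 24 (List.getD
    [11, 8, 14, 22, 19, 16, 12, 4, 23, 6, 5, 20, 9, 3, 17, 18, 10, 2, 21, 7, 0, 15, 13, 1] i 0)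

lemma sig_12 : ∀ i, sig 12 i = s12 i := by decide +kernel

/-- Masks of the operator `1 + t`. -/
def R0 (i : Fin 24) : ℕ := 2 ^ (i : ℕ) ^^^ 2 ^ (s0 i : ℕ)

/-- Masks of the operator `1 + c`. -/
def RC (i : Fin 24) : ℕ := 2 ^ (i : ℕ) ^^^ 2 ^ (s9 i : ℕ)

/-- Masks of the operator `1 + u + c²`. -/
def R1 (i : Fin 24) : ℕ := 2 ^ (i : ℕ) ^^^ 2 ^ (s8 i : ℕ) ^^^ 2 ^ (s12 i : ℕ)

/-- Masks of the operator `(1 + t)(1 + c + c²)`. -/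
def R2 (i : Fin 24) : ℕ :=
  2 ^ (i : ℕ) ^^^ 2 ^ (s9 i : ℕ) ^^^ 2 ^ (s12 i : ℕ) ^^^
    2 ^ (s0 i : ℕ) ^^^ 2 ^ (s2 i : ℕ) ^^^ 2 ^ (s1 i : ℕ)

/-- Certificate. -/
def tP (i : Fin 24) : ℕ := List.getD
    [1, 2, 4, 73, 81, 97, 65, 81, 2, 65, 97, 1, 65, 73, 4, 0, 97, 4, 0, 81, 1, 0, 73, 2] i 0

/-- Certificate. -/
def tP1 (i : Fin 24) : ℕ := List.getD
    [0, 0, 0, 0, 0, 0, 0, 128, 2, 513, 1537, 1, 66, 8258, 4, 155718, 32, 24646, 188518, 16, 3584,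
    450678, 8, 386] i 0

/-- Certificate. -/
def tQ (i : Fin 24) : ℕ := List.getD
    [454246, 451060, 426040, 456, 448, 464, 4048, 3728, 3984, 25487, 26207, 28255, 0, 8648, 25032,
    294968, 56, 0, 262144, 0, 0, 0, 0, 0] i 0

/-- Certificate. -/
def tQ1 (i : Fin 24) : ℕ := List.getD
    [0, 0, 0, 0, 0, 0, 0, 0, 0, 0, 0, 0, 64, 0, 0, 0, 96, 0, 0, 16, 97, 127, 8, 115] i 0

/-- Certificate. -/
def tU (i : Fin 24) : ℕ := List.getD
    [1050625, 8388866, 147460, 2983088, 524432, 66592, 7185592, 0, 0, 0, 0, 0, 0, 0, 0, 0, 0, 0, 0,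
    0, 0, 0, 0, 0] i 0

/-- Certificate. -/
def tU1 (i : Fin 24) : ℕ := List.getD
    [2049, 258, 16388, 8192, 128, 1024, 512, 144, 2, 576, 1056, 1, 64, 8200, 4, 294912, 32, 16384,
    32768, 16, 2048, 262144, 8, 256] i 0

/-- Certificate. -/
def tX0 (i : Fin 24) : ℕ := List.getD
    [64, 544384, 512, 8, 16, 548512, 0, 2688, 320, 0, 526976, 2560, 548480, 8512, 528000, 65,
    74048, 512, 544386, 2688, 64, 516, 131584, 544384] i 0

/-- Certificate. -/
def tY0 (i : Fin 24) : ℕ := List.getD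
    [0, 198, 64, 0, 64, 198, 0, 68, 1, 64, 196, 68, 198, 1, 196, 0, 1, 68, 198, 196, 1, 64, 68,
    196] i 0

/-- Certificate. -/
def tZ1 (i : Fin 24) : ℕ := List.getD
    [34820, 262401, 311298, 8280, 688, 1640, 833, 2128, 2435, 2116, 16928, 19461, 16898, 840,
    24838, 263208, 25604, 40972, 295088, 3201, 263201, 40984, 8578, 295058] i 0

lemma cert_E0 : ∀ i : Fin 24,
    2 ^ (i : ℕ) ^^^ 2 ^ ((6 : Fin 24) : ℕ) = comb (tX0 i) R0 ^^^ comb (tY0 i) RC := by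
  decide +kernel

lemma cert_E1 : ∀ i : Fin 24, comb (R0 i) tP = 2 ^ (i : ℕ) ^^^ comb (tP1 i) R1 := by
  decide +kernel

lemma cert_E1' : ∀ i : Fin 24, comb (RC i) tP = 0 := by decide +kernel

lemma cert_E2 : ∀ i : Fin 24, comb (R1 i) tQ = 2 ^ (i : ℕ) ^^^ comb (tQ1 i) R2 := by
  decide +kernel

lemma cert_E3 : ∀ i : Fin 24, comb (R2 i) tU = 2 ^ (i : ℕ) ^^^ comb (tU1 i) RC ^^^
    (if i = 6 ∨ i = 9 ∨ i = 12 then 2 ^ 24 - 1 else 0) := by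
  decide +kernel

lemma cert_Z1 : ∀ i : Fin 24, comb (R1 i) R0 = comb (tZ1 i) RC := by decide +kernel

lemma cert_Z2 : ∀ i : Fin 24, comb (R2 i) R1 = 0 := by decide +kernel

lemma cert_Z3 : ∀ i : Fin 24, comb (RC i) R2 = 0 := by decide +kernel

/-! ### Operators on functions on the group -/

/-- Left translation operator on functions. -/
def tl (s : G) : (G → k) →ₗ[k] (G → k) := LinearMap.funLeft k k (s * ·)

lemma tl_apply (s : G) (f : G → k) (h : G) : tl s f h = f (s * h) := rfl

/-- `1 + t`. -/
def d0 : (G → k) →ₗ[k] (G → k) := LinearMap.id + tl (e 0)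
/-- `1 + c`. -/
def dC : (G → k) →ₗ[k] (G → k) := LinearMap.id + tl (e 9)
/-- `1 + u + c²`. -/
def d1 : (G → k) →ₗ[k] (G → k) := LinearMap.id + tl (e 8) + tl (e 12)
/-- `(1 + t)(1 + c + c²)`. -/
def d2 : (G → k) →ₗ[k] (G → k) :=
  LinearMap.id + tl (e 9) + tl (e 12) + tl (e 0) + tl (e 2) + tl (e 1)

lemma d0_e (f : G → k) (i : Fin 24) : d0 f (e i) = ev (R0 i) (fun j => f (e j)) := by
  simp [d0, R0, tl_apply, ev_xor, ev_pow, e_mul, sig_0]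

lemma dC_e (f : G → k) (i : Fin 24) : dC f (e i) = ev (RC i) (fun j => f (e j)) := by
  simp [dC, RC, tl_apply, ev_xor, ev_pow, e_mul, sig_9]

lemma d1_e (f : G → k) (i : Fin 24) : d1 f (e i) = ev (R1 i) (fun j => f (e j)) := by
  simp [d1, R1, tl_apply, ev_xor, ev_pow, e_mul, sig_8, sig_12]

lemma d2_e (f : G → k) (i : Fin 24) : d2 f (e i) = ev (R2 i) (fun j => f (e j)) := by
  simp [d2, R2, tl_apply, ev_xor, ev_pow, e_mul, sig_0, sig_1, sig_2, sig_9, sig_12]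

lemma ext_e {f f' : G → k} (h : ∀ i, f (e i) = f' (e i)) : f = f' := by
  funext g
  rw [← e_idx g]
  exact h _

/-- The function on the group with given mask matrix applied to `f`. -/
def app (R : Fin 24 → ℕ) (f : G → k) : G → k := fun g => ev (R (idx g)) (fun j => f (e j))

lemma app_e (R : Fin 24 → ℕ) (f : G → k) (i : Fin 24) :
    app R f (e i) = ev (R i) (fun j => f (e j)) := by
  rw [app, idx_e]

lemma e_six : e 6 = 1 := by
  apply Subtype.ext
  ext i j
  fin_cases i <;> fin_cases j <;> rfl

lemma exact0 (f : G → k) (hC : dC f = 0) (h0 : d0 f = 0) (g : G) : f g = f 1 := by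
  have key := cert_E0 (idx g)
  have h := congrArg (fun m => ev m (fun j => f (e j))) key
  simp only [ev_xor, ev_pow, ev_comb, e_idx, e_six] at h
  rw [ev_zero _ _ (fun i => by rw [← d0_e, h0]; rfl),
    ev_zero _ _ (fun i => by rw [← dC_e, hC]; rfl), add_zero] at h
  exact (CharTwo.add_eq_zero).1 h

lemma exact1 (f : G → k) (h1 : d1 f = 0) : ∃ p, dC p = 0 ∧ d0 p = f := by
  refine ⟨app tP f, ext_e fun i => ?_, ext_e fun i => ?_⟩
  · rw [dC_e]
    simp only [app_e]
    rw [← ev_comb, cert_E1', ev_zero_mask]; rfl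
  · rw [d0_e]
    simp only [app_e]
    rw [← ev_comb, cert_E1, ev_xor, ev_pow, ev_comb,
      ev_zero _ _ (fun i => by rw [← d1_e, h1]; rfl), add_zero]

lemma exact2 (f : G → k) (h2 : d2 f = 0) : ∃ q, d1 q = f := by
  refine ⟨app tQ f, ext_e fun i => ?_⟩
  rw [d1_e]
  simp only [app_e]
  rw [← ev_comb, cert_E2, ev_xor, ev_pow, ev_comb,
    ev_zero _ _ (fun i => by rw [← d2_e, h2]; rfl), add_zero]

/-- The enumeration as an equivalence. -/
def eEquiv : Fin 24 ≃ G := ⟨e, idx, idx_e, e_idx⟩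

/-- The augmentation. -/
noncomputable def aug : (G → k) →ₗ[k] k := ∑ g : G, LinearMap.proj g

lemma aug_apply (f : G → k) : aug f = ∑ g, f g := by simp [aug]

lemma ev_full (f : G → k) : ev (2 ^ 24 - 1) (fun j => f (e j)) = aug f := by
  rw [aug_apply, ← eEquiv.sum_comp, ev]
  refine Finset.sum_congr rfl fun j _ => ?_
  rw [Nat.testBit_two_pow_sub_one]
  simp [eEquiv]

lemma exact3 (f : G → k) (hC : dC f = 0) (ha : aug f = 0) : ∃ q, d2 q = f := by
  refine ⟨app tU f, ext_e fun i => ?_⟩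
  rw [d2_e]
  simp only [app_e]
  rw [← ev_comb, cert_E3, ev_xor, ev_xor, ev_pow, ev_comb,
    ev_zero _ _ (fun i => by rw [← dC_e, hC]; rfl), add_zero]
  split
  · rw [ev_full, ha, add_zero]
  · rw [ev_zero_mask, add_zero]

lemma zero1 (f : G → k) (hC : dC f = 0) : d1 (d0 f) = 0 := by
  refine ext_e fun i => ?_
  rw [d1_e]
  simp only [d0_e]
  rw [← ev_comb, cert_Z1, ev_comb, ev_zero _ _ (fun i => by rw [← dC_e, hC]; rfl)]
  rfl

lemma zero2 (f : G → k) : d2 (d1 f) = 0 := by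
  refine ext_e fun i => ?_
  rw [d2_e]
  simp only [d1_e]
  rw [← ev_comb, cert_Z2, ev_zero_mask]
  rfl

lemma zero3 (f : G → k) : dC (d2 f) = 0 := by
  refine ext_e fun i => ?_
  rw [dC_e]
  simp only [d2_e]
  rw [← ev_comb, cert_Z3, ev_zero_mask]
  rfl

lemma aug_tl (s : G) (f : G → k) : aug (tl s f) = aug f := by
  simp only [aug_apply, tl_apply]
  exact Equiv.sum_comp (Equiv.mulLeft s) f

lemma zero4 (f : G → k) : aug (d2 f) = 0 := by
  simp only [d2, LinearMap.add_apply, map_add, aug_tl, LinearMap.id_apply]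
  generalize aug f = x
  revert x
  decide

/-! ### Generalities on group cohomology -/

open Limits groupCohomology

section general

variable {X : ShortComplex (Rep k G)} (hX : X.ShortExact)

include hX

lemma shift (n : ℕ) (h : ∀ m, IsZero (groupCohomology X.X₂ (m + 1))) :
    Module.finrank k (groupCohomology X.X₁ (n + 2)) =
      Module.finrank k (groupCohomology X.X₃ (n + 1)) := by
  have := isIso_δ_of_isZero hX (n + 1) (h n) (h (n + 1))
  exact (asIso (δ hX (n + 1) (n + 2) rfl)).toLinearEquiv.finrank_eq.symm

lemma low_zero (h : IsZero (groupCohomology X.X₂ 1))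
    (hs : ∀ x : X.X₃, (∀ g, X.X₃.ρ g x = x) → ∃ y : X.X₂, (∀ g, X.X₂.ρ g y = y) ∧ X.g.hom y = x) :
    Module.finrank k (groupCohomology X.X₁ 1) = 0 := by
  have h1 : Epi (δ hX 0 1 rfl) := epi_δ_of_isZero hX 0 h
  have hsurj : Function.Surjective (map (MonoidHom.id G) X.g 0).hom := by
    intro z
    obtain ⟨y, hy, hyx⟩ := hs ((H0Iso X.X₃).hom z).1 ((H0Iso X.X₃).hom z).2
    refine ⟨(H0Iso X.X₂).inv ⟨y, hy⟩, ?_⟩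
    apply (H0Iso X.X₃).toLinearEquiv.injective
    have := map_id_comp_H0Iso_hom_apply X.g ((H0Iso X.X₂).inv ⟨y, hy⟩)
    refine Eq.trans this ?_
    have h5 : (H0Iso X.X₂).hom ((H0Iso X.X₂).inv ⟨y, hy⟩) = ⟨y, hy⟩ :=
      (H0Iso X.X₂).toLinearEquiv.apply_symm_apply ⟨y, hy⟩
    apply Subtype.ext
    change X.g.hom ((H0Iso X.X₂).hom ((H0Iso X.X₂).inv ⟨y, hy⟩)).1 = ((H0Iso X.X₃).hom z).1
    rw [h5]
    exact hyx
  have h2 : Epi (map (MonoidHom.id G) X.g 0) := (ModuleCat.epi_iff_surjective _).2 hsurj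
  have h3 : δ hX 0 1 rfl = 0 := by
    rw [← cancel_epi (map (MonoidHom.id G) X.g 0), comp_zero]
    exact (mapShortComplex₃ hX (i := 0) rfl).zero
  have h4 : IsZero (groupCohomology X.X₁ 1) := by
    rw [h3] at h1
    exact IsZero.of_epi_zero (groupCohomology X.X₃ 0) (groupCohomology X.X₁ 1)
  have := ModuleCat.subsingleton_of_isZero h4
  exact Module.finrank_zero_of_subsingleton

lemma low_iso (h : IsZero (groupCohomology X.X₂ 1))
    (hs : ∀ y : X.X₂, (∀ g, X.X₂.ρ g y = y) → X.g.hom y = 0) :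
    Module.finrank k (groupCohomology X.X₁ 1) = Module.finrank k X.X₃.ρ.invariants := by
  have h1 : Epi (δ hX 0 1 rfl) := epi_δ_of_isZero hX 0 h
  have h2 : map (MonoidHom.id G) X.g 0 = 0 := by
    rw [← cancel_mono (H0Iso X.X₃).hom, map_id_comp_H0Iso_hom, zero_comp,
      ← cancel_epi (H0Iso X.X₂).inv, Iso.inv_hom_id_assoc, comp_zero]
    apply ModuleCat.hom_ext
    refine LinearMap.ext fun y => Subtype.ext ?_
    exact hs y.1 y.2
  have h3 : Mono (δ hX 0 1 rfl) :=
    (mapShortComplex₃_exact hX (i := 0) rfl).mono_g h2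
  have h4 : IsIso (δ hX 0 1 rfl) := isIso_of_mono_of_epi _
  rw [← (asIso (δ hX 0 1 rfl)).toLinearEquiv.finrank_eq,
    (H0Iso X.X₃).toLinearEquiv.finrank_eq]

end general

lemma isZero_of_retract {A B : Rep k G} (i : A ⟶ B) (p : B ⟶ A) (hip : i ≫ p = 𝟙 A) (n : ℕ)
    (h : IsZero (groupCohomology B n)) : IsZero (groupCohomology A n) := by
  rw [IsZero.iff_id_eq_zero]
  have h1 : map (MonoidHom.id G) i n ≫ map (MonoidHom.id G) p n = 𝟙 (groupCohomology A n) := by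
    have h2 := (groupCohomology.functor k G n).map_comp i p
    rw [hip, CategoryTheory.Functor.map_id] at h2
    exact h2.symm
  rw [← h1, h.eq_of_src (map (MonoidHom.id G) p n) 0, comp_zero]

lemma shortExact_mk {A B C : Rep k G} (f : A ⟶ B) (g : B ⟶ C) (hf : Function.Injective f.hom)
    (hg : Function.Surjective g.hom) (h0 : ∀ a, g.hom (f.hom a) = 0)
    (hex : ∀ b, g.hom b = 0 → ∃ a, f.hom a = b) :
    ∃ w : f ≫ g = 0, (ShortComplex.mk f g w).ShortExact := by
  have w : f ≫ g = 0 := by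
    apply Rep.hom_ext
    ext a
    exact h0 a
  refine ⟨w, ?_⟩
  have : Mono f := (Rep.mono_iff_injective f).2 hf
  have : Epi g := (Rep.epi_iff_surjective g).2 hg
  refine ⟨?_⟩
  rw [← ShortComplex.exact_map_iff_of_faithful _ (forget₂ (Rep k G) (ModuleCat k)),
    ShortComplex.moduleCat_exact_iff]
  exact hex

/-! ### Representations on spaces of functions -/

/-- Right regular representation on functions. -/
def rr : Representation k G (G → k) where
  toFun g := LinearMap.funLeft k k (· * g)
  map_one' := by ext; simp
  map_mul' _ _ := by ext; simp [mul_assoc]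

lemma rr_apply (g : G) (f : G → k) (h : G) : rr g f h = f (h * g) := rfl

/-- Submodules stable under translation. -/
def Stable (W : Submodule k (G → k)) : Prop := ∀ g, W ≤ W.comap (rr g)

/-- The representation on a stable submodule. -/
abbrev sub (W : Submodule k (G → k)) (hW : Stable W) : Rep k G :=
  Rep.of (rr.subrepresentation W hW)

lemma tl_comm (s g : G) (f : G → k) : tl s (rr g f) = rr g (tl s f) := by
  funext h
  simp [tl_apply, rr_apply, mul_assoc]

/-- Linear maps commuting with translation. -/
def Equivar (L : (G → k) →ₗ[k] (G → k)) : Prop := ∀ g f, L (rr g f) = rr g (L f)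

lemma equivar_id : Equivar LinearMap.id := fun _ _ => rfl
lemma equivar_tl (s : G) : Equivar (tl s) := fun _ _ => tl_comm _ _ _
lemma Equivar.add {L L'} (h : Equivar L) (h' : Equivar L') : Equivar (L + L') := fun g f => by
  simp [h g f, h' g f]

lemma equivar_d0 : Equivar d0 := equivar_id.add (equivar_tl _)
lemma equivar_dC : Equivar dC := equivar_id.add (equivar_tl _)
lemma equivar_d1 : Equivar d1 := (equivar_id.add (equivar_tl _)).add (equivar_tl _)
lemma equivar_d2 : Equivar d2 :=
  ((((equivar_id.add (equivar_tl _)).add (equivar_tl _)).add (equivar_tl _)).add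
    (equivar_tl _)).add (equivar_tl _)

lemma aug_rr (g : G) (f : G → k) : aug (rr g f) = aug f := by
  simp only [aug_apply, rr_apply]
  exact Equiv.sum_comp (Equiv.mulRight g) f

lemma stable_ker {L} (h : Equivar L) : Stable (LinearMap.ker L) := fun g f hf => by
  simp only [Submodule.mem_comap, LinearMap.mem_ker] at *
  rw [h, hf, map_zero]

lemma stable_top : Stable ⊤ := fun _ _ _ => trivial

lemma stable_M3 : Stable (LinearMap.ker dC ⊓ LinearMap.ker aug) := fun g f hf =>
  ⟨stable_ker equivar_dC g hf.1, by
    have := hf.2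
    simp only [LinearMap.mem_ker, SetLike.mem_coe] at *
    rw [aug_rr, this]⟩

/-- Morphisms between representations on stable submodules. -/
def mkHom {W W' : Submodule k (G → k)} (hW : Stable W) (hW' : Stable W')
    (L : (G → k) →ₗ[k] (G → k)) (hL : Equivar L) (h : ∀ f ∈ W, L f ∈ W') :
    sub W hW ⟶ sub W' hW' :=
  Rep.ofHom ⟨L.restrict h, fun g => by
    ext f : 1
    exact Subtype.ext (hL g f.1)⟩

lemma mkHom_apply {W W' : Submodule k (G → k)} (hW : Stable W) (hW' : Stable W')
    (L : (G → k) →ₗ[k] (G → k)) (hL : Equivar L) (h : ∀ f ∈ W, L f ∈ W') (f : sub W hW) :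
    ((mkHom hW hW' L hL h).hom f).1 = L f.1 := rfl

lemma acyclic_top (n : ℕ) : IsZero (groupCohomology (sub ⊤ stable_top) (n + 1)) := by
  let T : Rep k (⊥ : Subgroup G) := Rep.trivial k (⊥ : Subgroup G) k
  have h : IsZero (groupCohomology (Rep.coind (⊥ : Subgroup G).subtype T) (n + 1)) :=
    (isZero_groupCohomology_succ_of_subsingleton T n).of_iso (coindIso T (n + 1))
  refine isZero_of_retract (B := Rep.coind (⊥ : Subgroup G).subtype T)
    (Rep.ofHom ⟨LinearMap.codRestrict _ (Submodule.subtype _) ?_, ?_⟩)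
    (Rep.ofHom ⟨LinearMap.codRestrict _ (Submodule.subtype _) ?_, ?_⟩) ?_ (n + 1) h
  · rintro f ⟨g, hg⟩ x
    obtain rfl := Subgroup.mem_bot.1 hg
    simp [T]
  · intro g
    rfl
  · intro f
    trivial
  · intro g
    rfl
  · rfl

/-- The invariants of `c`. -/
abbrev A0 : Rep k G := sub (LinearMap.ker dC) (stable_ker equivar_dC)
/-- Functions on the group. -/
abbrev F : Rep k G := sub ⊤ stable_top
/-- First syzygy. -/
abbrev M1 : Rep k G := sub (LinearMap.ker d1) (stable_ker equivar_d1)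
/-- Second syzygy. -/
abbrev M2 : Rep k G := sub (LinearMap.ker d2) (stable_ker equivar_d2)
/-- Third syzygy. -/
noncomputable abbrev M3 : Rep k G := sub (LinearMap.ker dC ⊓ LinearMap.ker aug) stable_M3
/-- The trivial representation. -/
abbrev K : Rep k G := Rep.trivial k G k

lemma mem_kerC {f : G → k} (hf : dC f = 0) (h : G) : f (e 9 * h) = f h := by
  have := congrFun hf h
  exact ((CharTwo.add_eq_zero).1 this).symm

lemma e_sq : e 12 = e 9 * e 9 := by rw [e_mul, sig_9]; rfl
lemma e_cube : e 9 * e 12 = 1 := by rw [e_mul, sig_9, ← e_six]; rfl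

/-- The projector `1 + c + c²`. -/
def prj : (G → k) →ₗ[k] (G → k) := LinearMap.id + tl (e 9) + tl (e 12)
lemma equivar_prj : Equivar prj := (equivar_id.add (equivar_tl _)).add (equivar_tl _)

lemma three_aux : ∀ x y z : k, x + y + z + (y + z + x) = 0 := by decide

lemma one_aux : ∀ x : k, x + x + x = x := by decide

lemma dC_prj (f : G → k) : dC (prj f) = 0 := by
  funext h
  have h1 : e 9 * (e 9 * h) = e 12 * h := by rw [← mul_assoc, ← e_sq]
  have h2 : e 12 * (e 9 * h) = h := by
    have : e 12 * e 9 = 1 := by rw [← e_cube, e_sq, mul_assoc]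
    rw [← mul_assoc, this, one_mul]
  simp only [dC, prj, LinearMap.add_apply, Pi.add_apply, LinearMap.id_apply, tl_apply, h1, h2,
    Pi.zero_apply]
  exact three_aux _ _ _

lemma prj_of_mem (f : G → k) (hf : dC f = 0) : prj f = f := by
  funext h
  simp only [prj, LinearMap.add_apply, Pi.add_apply, LinearMap.id_apply, tl_apply, e_sq,
    mul_assoc, mem_kerC hf]
  exact one_aux _

lemma acyclic_A0 (n : ℕ) : IsZero (groupCohomology A0 (n + 1)) := by
  refine isZero_of_retract (B := F) (mkHom _ _ LinearMap.id equivar_id fun _ _ => trivial)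
    (mkHom _ _ prj equivar_prj fun f _ => dC_prj f) ?_ (n + 1) (acyclic_top n)
  apply Rep.hom_ext
  apply Representation.IntertwiningMap.ext
  refine LinearMap.ext fun f => ?_
  exact Subtype.ext (prj_of_mem f.1 f.2)

/-! ### The four short exact sequences -/

/-- Constant function with value `x`. -/
def cst : k →ₗ[k] (G → k) := LinearMap.pi fun _ => LinearMap.id

lemma cst_apply (x : k) (g : G) : cst x g = x := rfl

lemma tl_cst (s : G) (x : k) : tl s (cst x) = cst x := rfl

lemma dC_cst (x : k) : dC (cst x) = 0 := by
  simp only [dC, LinearMap.add_apply, tl_cst, LinearMap.id_apply]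
  exact CharTwo.add_self_eq_zero _

lemma d0_cst (x : k) : d0 (cst x) = 0 := by
  simp only [d0, LinearMap.add_apply, tl_cst, LinearMap.id_apply]
  exact CharTwo.add_self_eq_zero _

lemma d1_cst (x : k) : d1 (cst x) = cst x := by
  simp only [d1, LinearMap.add_apply, tl_cst, LinearMap.id_apply]
  rw [CharTwo.add_self_eq_zero, zero_add]

lemma d2_cst (x : k) : d2 (cst x) = 0 := by
  simp only [d2, LinearMap.add_apply, tl_cst, LinearMap.id_apply]
  simp only [CharTwo.add_self_eq_zero, zero_add]

lemma aug_cst (x : k) : aug (cst x) = 0 := by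
  rw [aug_apply, ← eEquiv.sum_comp]
  simp only [cst_apply, Finset.sum_const, Finset.card_univ, Fintype.card_fin]
  revert x
  decide

lemma inv_cst {f : G → k} (hf : ∀ g, rr g f = f) : f = cst (f 1) := by
  funext g
  have := congrFun (hf g) 1
  rw [rr_apply, one_mul] at this
  exact this

lemma cst_inv (x : k) (g : G) : rr g (cst x) = cst x := rfl

/-- `k → A0`. -/
def iK : K ⟶ A0 := Rep.ofHom ⟨cst.codRestrict _ dC_cst, fun _ => rfl⟩

/-- `A0 → k`. -/
noncomputable def pK : A0 ⟶ K := Rep.ofHom ⟨aug ∘ₗ Submodule.subtype _, fun g => by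
  ext f : 1
  exact aug_rr g f.1⟩

/-- `A0 → M1`. -/
def p1 : A0 ⟶ M1 := mkHom _ _ d0 equivar_d0 fun f hf => zero1 f hf
/-- `M1 → F`. -/
def i1 : M1 ⟶ F := mkHom _ _ LinearMap.id equivar_id fun _ _ => trivial
/-- `F → M2`. -/
def p2 : F ⟶ M2 := mkHom _ _ d1 equivar_d1 fun f _ => zero2 f
/-- `M2 → F`. -/
def i2 : M2 ⟶ F := mkHom _ _ LinearMap.id equivar_id fun _ _ => trivial
/-- `F → M3`. -/
noncomputable def p3 : F ⟶ M3 := mkHom _ _ d2 equivar_d2 fun f _ => ⟨zero3 f, zero4 f⟩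
/-- `M3 → A0`. -/
noncomputable def i3 : M3 ⟶ A0 := mkHom _ _ LinearMap.id equivar_id fun _ h => h.1

lemma ses1 : ∃ w : iK ≫ p1 = 0, (ShortComplex.mk iK p1 w).ShortExact := by
  apply shortExact_mk
  · intro x y h
    exact congrFun (congrArg Subtype.val h) 1
  · intro f
    obtain ⟨p, hC, hp⟩ := exact1 f.1 f.2
    exact ⟨⟨p, hC⟩, Subtype.ext hp⟩
  · intro x
    exact Subtype.ext (d0_cst x)
  · intro f hf
    refine ⟨f.1 1, Subtype.ext ?_⟩
    funext g
    exact (exact0 f.1 f.2 (congrArg Subtype.val hf) g).symm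

lemma ses2 : ∃ w : i1 ≫ p2 = 0, (ShortComplex.mk i1 p2 w).ShortExact := by
  apply shortExact_mk
  · intro x y h
    have h' := congrArg Subtype.val h
    exact Subtype.ext h'
  · intro f
    obtain ⟨p, hp⟩ := exact2 f.1 f.2
    exact ⟨⟨p, trivial⟩, Subtype.ext hp⟩
  · intro f
    exact Subtype.ext f.2
  · intro f hf
    exact ⟨⟨f.1, congrArg Subtype.val hf⟩, rfl⟩

lemma ses3 : ∃ w : i2 ≫ p3 = 0, (ShortComplex.mk i2 p3 w).ShortExact := by
  apply shortExact_mk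
  · intro x y h
    have h' := congrArg Subtype.val h
    exact Subtype.ext h'
  · intro f
    obtain ⟨p, hp⟩ := exact3 f.1 f.2.1 f.2.2
    exact ⟨⟨p, trivial⟩, Subtype.ext hp⟩
  · intro f
    exact Subtype.ext f.2
  · intro f hf
    exact ⟨⟨f.1, congrArg Subtype.val hf⟩, rfl⟩

lemma aug_prj_single (x : k) : aug (prj (Pi.single 1 x)) = x := by
  simp only [prj, LinearMap.add_apply, map_add, aug_tl, LinearMap.id_apply]
  have : aug (Pi.single (1 : G) x) = x := by
    rw [aug_apply, Finset.sum_pi_single']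
    simp
  rw [this, CharTwo.add_self_eq_zero, zero_add]

lemma ses4 : ∃ w : i3 ≫ pK = 0, (ShortComplex.mk i3 pK w).ShortExact := by
  apply shortExact_mk
  · intro x y h
    have h' := congrArg Subtype.val h
    exact Subtype.ext h'
  · intro x
    exact ⟨⟨prj (Pi.single 1 x), dC_prj _⟩, aug_prj_single x⟩
  · intro f
    exact f.2.2
  · intro f hf
    exact ⟨⟨f.1, f.2, hf⟩, rfl⟩

/-! ### Conclusion -/

/-- Dimension of cohomology. -/
noncomputable def hd (A : Rep k G) (n : ℕ) : ℕ := Module.finrank k (groupCohomology A n)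

lemma shift1 (n : ℕ) : hd K (n + 2) = hd M1 (n + 1) := shift ses1.2 n acyclic_A0
lemma shift2 (n : ℕ) : hd M1 (n + 2) = hd M2 (n + 1) := shift ses2.2 n acyclic_top
lemma shift3 (n : ℕ) : hd M2 (n + 2) = hd M3 (n + 1) := shift ses3.2 n acyclic_top
lemma shift4 (n : ℕ) : hd M3 (n + 2) = hd K (n + 1) := shift ses4.2 n acyclic_A0

lemma inv_sub {W : Submodule k (G → k)} {hW : Stable W} (x : sub W hW)
    (hx : ∀ g, (sub W hW).ρ g x = x) : x.1 = cst (x.1 1) :=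
  inv_cst fun g => congrArg Subtype.val (hx g)

lemma low_zero' {A B C : Rep k G} {f : A ⟶ B} {g : B ⟶ C}
    (hw : ∃ w : f ≫ g = 0, (ShortComplex.mk f g w).ShortExact)
    (h : IsZero (groupCohomology B 1))
    (hs : ∀ x : C, (∀ g, C.ρ g x = x) → ∃ y : B, (∀ g, B.ρ g y = y) ∧ g.hom y = x) :
    hd A 1 = 0 := by
  obtain ⟨w, hw⟩ := hw
  exact low_zero (X := ShortComplex.mk f g w) hw h hs

lemma l1 : hd K 1 = 0 := by
  refine low_zero' ses1 (acyclic_A0 0) fun x hx => ⟨0, fun g => map_zero _, ?_⟩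
  have h1 := inv_sub x hx
  have h2 : d1 x.1 = 0 := x.2
  rw [h1, d1_cst, ← h1] at h2
  rw [map_zero]
  exact Subtype.ext h2.symm

lemma l2 : hd M1 1 = 0 := by
  refine low_zero' ses2 (acyclic_top 0) fun x hx => ⟨⟨cst (x.1 1), trivial⟩, fun g => rfl, ?_⟩
  exact Subtype.ext ((d1_cst _).trans (inv_sub x hx).symm)

lemma finrank_M3 : Module.finrank k M3.ρ.invariants = 1 := by
  refine finrank_eq_one (⟨⟨cst 1, dC_cst 1, aug_cst 1⟩, fun g => rfl⟩ : M3.ρ.invariants) ?_ ?_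
  · intro h
    have : (1 : k) = 0 := congrFun (congrArg (fun z => z.1.1) h) 1
    exact one_ne_zero this
  · intro w
    refine ⟨w.1.1 1, Subtype.ext (Subtype.ext ?_)⟩
    refine Eq.trans ?_ (inv_sub w.1 w.2).symm
    funext g
    exact mul_one _

lemma finrank_K : Module.finrank k K.ρ.invariants = 1 := by
  rw [Representation.invariants_eq_top, finrank_top]
  exact Module.finrank_self k

lemma l3 : hd M2 1 = 1 := by
  refine (low_iso ses3.2 (acyclic_top 0) fun y hy => ?_).trans finrank_M3
  apply Subtype.ext
  change d2 y.1 = 0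
  rw [inv_sub y hy, d2_cst]

lemma l4 : hd M3 1 = 1 := by
  refine (low_iso ses4.2 (acyclic_A0 0) fun y hy => ?_).trans finrank_K
  change aug y.1 = 0
  rw [inv_sub y hy, aug_cst]

lemma h_zero : hd K 0 = 1 := (H0Iso K).toLinearEquiv.finrank_eq.trans finrank_K

lemma period (n : ℕ) : hd K (n + 5) = hd K (n + 1) := by
  rw [shift1 (n + 3), shift2 (n + 2), shift3 (n + 1), shift4 n]

lemma main : ∀ q : ℕ, hd K q = if q % 4 = 0 ∨ q % 4 = 3 then 1 else 0
  | 0 => by simp [h_zero]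
  | 1 => by simp [l1]
  | 2 => by simp [shift1 0, l2]
  | 3 => by simp [shift1 1, shift2 0, l3]
  | 4 => by simp [shift1 2, shift2 1, shift3 0, l4]
  | n + 5 => by
    have h : (n + 5) % 4 = (n + 1) % 4 := by omega
    rw [period, main (n + 1), h]

end BinTet


/-- For the binary tetrahedral group Te ≅ SL₂(F₃),
H^q(Te; F₂) ≅ F₂ if q ≡ 0, 3 mod 4 and vanishes if q ≡ 1, 2 mod 4. -/
theorem stmt_6 (q : ℕ) :
    Module.finrank (ZMod 2)
      (groupCohomology
        (Rep.trivial (ZMod 2) (Matrix.SpecialLinearGroup (Fin 2) (ZMod 3)) (ZMod 2)) q) =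
      (if q % 4 = 0 ∨ q % 4 = 3 then 1 else 0) := by
  exact BinTet.main q
end
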